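/- Elimination of an independent variable in a symmetric rule: let (P, R) be a deduction system and x ∈ P a variable occurring in exactly one rule r, which is symmetric: r = [x, x_1, ..., x_{τ−1}]. Then the minimum number of initial propositions whose closure is P for (P, R) equals that for (P \ {x}, R \ {r}), i.e. min(P,R) = min(P∖{x}, R∖{r}). -/

import Mathlib

/-- Deduction closure of `S` under a rule set `R`. -/
inductive Closure {P : Type*} (R : Set (Set P × P)) (S : Set P) : P → Prop
  | mem {p} : p ∈ S → Closure R S p
  | rule {r} : r ∈ R → (∀ q ∈ r.1, Closure R S q) → Closure R S r.2

theorem Closure.mono_aux {P : Type*} {R R' : Set (Set P × P)} {S S' : Set P} (hR : R ⊆ R')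
    (hS : S ⊆ S') {p : P} (h : Closure R S p) : Closure R' S' p := by
  induction h with
  | mem h => exact .mem (hS h)
  | rule hr _ ih => exact .rule (hR hr) ih

theorem elim_aux {P : Type*} [DecidableEq P] (R : Set (Set P × P))
    (M : Finset P) (x : P) (hx : x ∈ M)
    (hindep : ∀ r ∈ R, x ∉ r.1 ∧ x ≠ r.2) (S : Finset P)
    (hS : ∀ p, Closure (R ∪ {r | ∃ m ∈ M, r = (↑(M.erase m), m)}) ↑S p) :
    ∃ S' : Finset P, x ∉ S' ∧ S'.card ≤ S.card ∧ ∀ p, p ≠ x → Closure R ↑S' p := by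
  by_cases hA : x ∈ S ∧ ∃ m ∈ M, m ≠ x ∧ ∀ q ∈ M, q ≠ x → q ≠ m → Closure R ↑(S.erase x) q
  · obtain ⟨hxS, m, hm, hmx, hq⟩ := hA
    refine ⟨insert m (S.erase x), by simp [hmx.symm], ?_, ?_⟩
    · have h1 := Finset.card_insert_le m (S.erase x)
      have h2 := Finset.card_erase_add_one hxS
      omega
    · intro p hp
      have h := hS p
      induction h with
      | mem h => exact .mem (by simp at h ⊢; tauto)
      | @rule r hr _ ih =>
        rcases hr with hr | ⟨m', hm', rfl⟩
        · exact .rule hr fun q hq' => ih q hq' fun e => (hindep r hr).1 (e ▸ hq')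
        · by_cases e : m' = m
          · exact .mem (by simp [e])
          · exact (hq m' hm' hp e).mono_aux subset_rfl (by simp)
  · refine ⟨S.erase x, by simp, Finset.card_erase_le, ?_⟩
    have key : ∀ p, (p ≠ x → Closure R ↑(S.erase x) p) ∧
        (p = x → x ∉ S → ∀ q ∈ M, q ≠ x → Closure R ↑(S.erase x) q) := by
      intro p
      have h := hS p
      induction h with
      | mem h =>
        refine ⟨fun hp => .mem (by simp at h ⊢; tauto), fun e hn => ?_⟩
        subst e
        exact absurd h hn
      | @rule r hr _ ih =>
        rcases hr with hr | ⟨m', hm', rfl⟩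
        · exact ⟨fun _ => .rule hr fun q hq' => (ih q hq').1 fun e => (hindep r hr).1 (e ▸ hq'),
            fun e => absurd e.symm (hindep r hr).2⟩
        · simp only [Finset.mem_coe, Finset.mem_erase] at ih
          refine ⟨fun hp => ?_, fun e hn q hqM hqx => ?_⟩
          · by_cases hxS : x ∈ S
            · exact absurd ⟨hxS, m', hm', hp, fun q hqM hqx hqm => (ih q ⟨hqm, hqM⟩).1 hqx⟩ hA
            · exact (ih x ⟨Ne.symm hp, hx⟩).2 rfl hxS m' hm' hp
          · have e' : m' = x := e
            exact (ih q ⟨by rw [e']; exact hqx, hqM⟩).1 hqx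
    exact fun p => (key p).1

theorem stmt_16 {P : Type*} [Fintype P] [DecidableEq P] (R : Set (Set P × P))
    (M : Finset P) (x : P) (hx : x ∈ M) (hM : 2 ≤ M.card)
    -- x is independent: it occurs in no rule of R
    (hindep : ∀ r ∈ R, x ∉ r.1 ∧ x ≠ r.2) :
    -- minimum of the original system (R together with the symmetric rule
    -- [x, x₁, …, x_{τ-1}] whose member set is M)
    sInf {n : ℕ | ∃ S : Finset P, S.card = n ∧
        ∀ p, Closure (R ∪ {r | ∃ m ∈ M, r = (↑(M.erase m), m)}) ↑S p} =
    -- minimum of the system (P ∖ {x}, R ∖ {r})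
    sInf {n : ℕ | ∃ S : Finset P, x ∉ S ∧ S.card = n ∧
        ∀ p, p ≠ x → Closure R ↑S p} := by
  apply le_antisymm
  · obtain ⟨S, _, hc, hS⟩ := Nat.sInf_mem (s := {n : ℕ | ∃ S : Finset P, x ∉ S ∧ S.card = n ∧
        ∀ p, p ≠ x → Closure R ↑S p})
      ⟨_, Finset.univ.erase x, by simp, rfl, fun p hp => .mem (by simp [hp])⟩
    rw [← hc]
    refine Nat.sInf_le ⟨S, rfl, fun p => ?_⟩
    have h1 : ∀ p, p ≠ x →
        Closure (R ∪ {r | ∃ m ∈ M, r = (↑(M.erase m), m)}) (S : Set P) p :=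
      fun p hp => (hS p hp).mono_aux Set.subset_union_left subset_rfl
    by_cases hp : p = x
    · subst hp
      exact Closure.rule (r := (↑(M.erase p), p)) (Or.inr ⟨p, hx, rfl⟩)
        fun q hq => h1 q (by simp at hq; exact hq.2)
    · exact h1 p hp
  · obtain ⟨S, hc, hS⟩ := Nat.sInf_mem (s := {n : ℕ | ∃ S : Finset P, S.card = n ∧
        ∀ p, Closure (R ∪ {r | ∃ m ∈ M, r = (↑(M.erase m), m)}) ↑S p})
      ⟨_, Finset.univ, rfl, fun p => .mem (by simp)⟩
    rw [← hc]
    obtain ⟨S', hxS', hle, hS'⟩ := elim_aux R M x hx hindep S hS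
    refine le_trans (Nat.sInf_le ?_) hle
    exact ⟨S', hxS', rfl, hS'⟩
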